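/- Let p ≥ 3, let (β,h) be a p-special point with unique global maximizer m_* of H = H_{β,h,p}, let X ~ P_{β,h,p}, and set ε := 0.24. Then for every c with 0 < c < −H^{(4)}(m_*)/24 there exist C > 0 and N₀ such that for all N ≥ N₀, P( |S_N/N − m_*| ≥ N^{−1/4+ε} ) ≤ C N^{3/2} exp(−c N^{4ε}). -/

import Mathlib

open Real MeasureTheory Filter
open scoped BigOperators Topology

noncomputable section

/-- The spin value (`±1`) of a Boolean coordinate. -/
def spin (b : Bool) : ℝ := if b then 1 else -1

/-- The total magnetization `S_N = ∑ᵢ Xᵢ` of a configuration. -/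
def mag {N : ℕ} (x : Fin N → Bool) : ℝ := ∑ i, spin (x i)

/-- The Hamiltonian of the `p`-spin Curie-Weiss model:
`β N^{1-p} ∑_{i₁,…,i_p} x_{i₁} ⋯ x_{i_p} + h ∑ᵢ xᵢ`. -/
def cwHamiltonian (p N : ℕ) (β h : ℝ) (x : Fin N → Bool) : ℝ :=
  β * (N : ℝ) ^ ((1 : ℤ) - (p : ℤ)) * (∑ i : Fin p → Fin N, ∏ j, spin (x (i j)))
    + h * mag x

/-- The (unnormalized) Gibbs weight of a configuration. -/
def cwWeight (p N : ℕ) (β h : ℝ) (x : Fin N → Bool) : ℝ :=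
  Real.exp (cwHamiltonian p N β h x)

/-- The probability of an event `E` under the `p`-spin Curie-Weiss measure `P_{β,h,p}`. -/
def cwProb (p N : ℕ) (β h : ℝ) (E : Set (Fin N → Bool)) : ℝ :=
  (∑ x : Fin N → Bool, E.indicator (cwWeight p N β h) x) /
    ∑ x : Fin N → Bool, cwWeight p N β h x

/-- Conditional probability of `E` given `A` under the `p`-spin Curie-Weiss measure. -/
def cwCondProb (p N : ℕ) (β h : ℝ) (E A : Set (Fin N → Bool)) : ℝ :=
  cwProb p N β h (E ∩ A) / cwProb p N β h A

/-- The binary entropy function `I(x) = ½[(1+x)log(1+x) + (1-x)log(1-x)]`. -/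
def binEnt (x : ℝ) : ℝ := (1/2) * ((1+x) * Real.log (1+x) + (1-x) * Real.log (1-x))

/-- The function `H_{β,h,p}(x) = βxᵖ + hx - I(x)`. -/
def Hfun (p : ℕ) (β h : ℝ) (x : ℝ) : ℝ := β * x ^ p + h * x - binEnt x

/-- `m` is a global maximizer of `H_{β,h,p}` on `[-1,1]`, lying in `(-1,1)`. -/
def isMaximizer (p : ℕ) (β h m : ℝ) : Prop :=
  m ∈ Set.Ioo (-1 : ℝ) 1 ∧ ∀ x ∈ Set.Icc (-1 : ℝ) 1, Hfun p β h x ≤ Hfun p β h m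

/-- `m` is the unique global maximizer of `H_{β,h,p}`. -/
def isUniqueMaximizer (p : ℕ) (β h m : ℝ) : Prop :=
  isMaximizer p β h m ∧ ∀ m', isMaximizer p β h m' → m' = m

/-- `(β,h)` is a `p`-regular point with unique global maximizer `m`. -/
def pRegular (p : ℕ) (β h m : ℝ) : Prop :=
  isUniqueMaximizer p β h m ∧ iteratedDeriv 2 (Hfun p β h) m < 0

/-- `(β,h)` is a `p`-special point with unique global maximizer `m`. -/
def pSpecial (p : ℕ) (β h m : ℝ) : Prop :=
  isUniqueMaximizer p β h m ∧ iteratedDeriv 2 (Hfun p β h) m = 0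

/-- `(β,h)` is a `p`-critical point: `H_{β,h,p}` has more than one global maximizer. -/
def pCritical (p : ℕ) (β h : ℝ) : Prop :=
  ∃ m₁ m₂, m₁ ≠ m₂ ∧ isMaximizer p β h m₁ ∧ isMaximizer p β h m₂

/-- The probability assigned to a set `S ⊆ ℝ` by the centered Gaussian with variance `v`. -/
def gaussProb (v : ℝ) (S : Set ℝ) : ℝ :=
  ∫ t in S, (Real.sqrt (2 * Real.pi * v))⁻¹ * Real.exp (-t ^ 2 / (2 * v))

/-- The CDF of the centered Gaussian with variance `v`. -/
def gaussCDF (v x : ℝ) : ℝ := gaussProb v (Set.Iic x)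

/-- The standard normal CDF `Φ`. -/
def stdNormCDF (x : ℝ) : ℝ := gaussCDF 1 x

/-- The CDF of the limit law `F` at a `p`-special point, where `c = H⁽⁴⁾(m_*)`:
`dF(x) = (2/Γ(1/4)) (-c/24)^{1/4} exp(c x⁴/24) dx`. -/
def specialCDF (c x : ℝ) : ℝ :=
  ∫ t in Set.Iic x, (2 / Real.Gamma (1/4)) * ((-c) / 24) ^ ((1:ℝ)/4) * Real.exp (c * t ^ 4 / 24)

/-- The inverse hyperbolic tangent `tanh⁻¹(t) = ½ log((1+t)/(1-t))`. -/
def arctanh (t : ℝ) : ℝ := (1/2) * Real.log ((1+t)/(1-t))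

/-- The function `g(t) = tanh⁻¹(t)/(p t^{p-1})`, so that the maximum pseudolikelihood
estimate of `β` is `g(X̄)`. -/
def gMPL (p : ℕ) (t : ℝ) : ℝ := arctanh t / (p * t ^ (p - 1))

/-- The threshold `β*(p) = inf{β ≥ 0 : sup_{x∈[0,1]} H_{β,0,p}(x) > 0}`. -/
def betaStar (p : ℕ) : ℝ := sInf {b : ℝ | 0 ≤ b ∧ ∃ x ∈ Set.Icc (0:ℝ) 1, 0 < Hfun p b 0 x}

/-- If `a t³ ≤ b t⁴` for all `t` near zero, then `a = 0`. -/
lemma eq_zero_of_eventually_cube_le {a b : ℝ} (hab : ∀ᶠ t in 𝓝 (0 : ℝ), a * t ^ 3 ≤ b * t ^ 4) :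
    a = 0 := by
  have key : ∀ {a : ℝ}, (∀ᶠ t in 𝓝 (0 : ℝ), a * t ^ 3 ≤ b * t ^ 4) → a ≤ 0 := by
    intro a ha
    have hlim : Tendsto (fun t : ℝ => b * t) (𝓝[>] 0) (𝓝 0) := by
      have : Tendsto (fun t : ℝ => b * t) (𝓝 0) (𝓝 (b * 0)) := tendsto_id.const_mul b
      rw [mul_zero] at this
      exact this.mono_left nhdsWithin_le_nhds
    refine ge_of_tendsto hlim ?_
    filter_upwards [ha.filter_mono nhdsWithin_le_nhds, self_mem_nhdsWithin] with t ht ht0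
    have ht3 : 0 < t ^ 3 := pow_pos ht0 3
    refine le_of_mul_le_mul_right ?_ ht3
    linarith [show b * t * t ^ 3 = b * t ^ 4 by ring]
  refine le_antisymm (key hab) ?_
  have hneg : ∀ᶠ t in 𝓝 (0 : ℝ), -a * t ^ 3 ≤ b * t ^ 4 := by
    have hc : Tendsto (fun t : ℝ => -t) (𝓝 0) (𝓝 0) := by
      simpa using (continuous_neg (G := ℝ)).tendsto 0
    filter_upwards [hc.eventually hab] with t ht
    linarith [show a * (-t) ^ 3 = -a * t ^ 3 by ring, show b * (-t) ^ 4 = b * t ^ 4 by ring]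
  linarith [key hneg]

/-- At a local maximum where the second derivative vanishes, the function drops at least
quartically, with any rate below the fourth Taylor coefficient. -/
lemma eventually_le_sub_quartic {f : ℝ → ℝ} {s : Set ℝ} {m c : ℝ} (hs : Convex ℝ s)
    (hso : IsOpen s) (hms : m ∈ s) (hf : ContDiffOn ℝ 4 f s) (hmax : IsLocalMax f m)
    (h₂ : iteratedDeriv 2 f m = 0) (hc : c < -(iteratedDeriv 4 f m) / 24) :
    ∀ᶠ x in 𝓝 m, f x ≤ f m - c * (x - m) ^ 4 := by
  have htaylor := taylor_isLittleO (n := 4) hs hms (mod_cast hf)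
  rw [hso.nhdsWithin_eq hms] at htaylor
  have hat : ContDiffAt ℝ 4 f m := hf.contDiffAt (hso.mem_nhds hms)
  have hd : ∀ k : ℕ, k ≤ 4 → iteratedDerivWithin k f s m = iteratedDeriv k f m := fun k hk =>
    iteratedDerivWithin_eq_iteratedDeriv hso.uniqueDiffOn (hat.of_le (mod_cast hk)) hms
  have h₁ : iteratedDeriv 1 f m = 0 := by
    rw [iteratedDeriv_one]; exact hmax.deriv_eq_zero
  set d₃ := iteratedDeriv 3 f m
  set d₄ := iteratedDeriv 4 f m
  have hpoly : ∀ x, taylorWithinEval f 4 s m x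
      = f m + d₃ / 6 * (x - m) ^ 3 + d₄ / 24 * (x - m) ^ 4 := by
    intro x
    rw [taylor_within_apply]
    simp only [Finset.sum_range_succ, Finset.sum_range_zero, smul_eq_mul]
    rw [hd 0 (by norm_num), hd 1 (by norm_num), hd 2 (by norm_num), hd 3 (by norm_num),
      hd 4 (by norm_num), h₁, h₂, iteratedDeriv_zero]
    simp only [Nat.factorial]
    push_cast
    ring
  simp only [hpoly] at htaylor
  have hbound : ∀ ε : ℝ, 0 < ε → ∀ᶠ x in 𝓝 m,
      |f x - (f m + d₃ / 6 * (x - m) ^ 3 + d₄ / 24 * (x - m) ^ 4)| ≤ ε * (x - m) ^ 4 := by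
    intro ε hε
    filter_upwards [htaylor.def hε] with x hx
    rwa [Real.norm_eq_abs, Real.norm_eq_abs,
      abs_of_nonneg (show (0 : ℝ) ≤ (x - m) ^ 4 by positivity)] at hx
  have h₃ : d₃ / 6 = 0 := by
    apply eq_zero_of_eventually_cube_le (b := 1 - d₄ / 24)
    have hshift : Tendsto (fun t : ℝ => m + t) (𝓝 0) (𝓝 m) := by
      have hcont : Continuous fun t : ℝ => m + t := by fun_prop
      simpa using hcont.tendsto 0
    filter_upwards [hshift.eventually hmax, hshift.eventually (hbound 1 one_pos)] with t ht₁ ht₂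
    rw [abs_le] at ht₂
    simp only [add_sub_cancel_left] at ht₂
    linarith [ht₂.1]
  filter_upwards [hbound (-d₄ / 24 - c) (by linarith)] with x hx
  rw [h₃, abs_le] at hx
  linarith [hx.2]

lemma hasDerivAt_binEnt {x : ℝ} (hx : x ∈ Set.Ioo (-1 : ℝ) 1) :
    HasDerivAt binEnt (arctanh x) x := by
  have h₁ : HasDerivAt (fun y : ℝ => 1 + y) 1 x := by simpa using (hasDerivAt_id x).const_add 1
  have h₂ : HasDerivAt (fun y : ℝ => 1 - y) (-1) x := by simpa using (hasDerivAt_id x).const_sub 1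
  have hp : (0 : ℝ) < 1 + x := by linarith [hx.1]
  have hn : (0 : ℝ) < 1 - x := by linarith [hx.2]
  have := ((h₁.mul (h₁.log hp.ne')).add (h₂.mul (h₂.log hn.ne'))).const_mul (1 / 2 : ℝ)
  refine this.congr_deriv ?_
  rw [arctanh, Real.log_div hp.ne' hn.ne']
  field_simp
  ring

lemma continuous_Hfun (p : ℕ) (β h : ℝ) : Continuous (Hfun p β h) := by
  have h₁ : Continuous fun x : ℝ => (1 + x) * Real.log (1 + x) :=
    Real.continuous_mul_log.comp (continuous_const.add continuous_id)
  have h₂ : Continuous fun x : ℝ => (1 - x) * Real.log (1 - x) :=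
    Real.continuous_mul_log.comp (continuous_const.sub continuous_id)
  unfold Hfun binEnt
  fun_prop

lemma contDiffOn_Hfun (p : ℕ) (β h : ℝ) : ContDiffOn ℝ 4 (Hfun p β h) (Set.Ioo (-1) 1) := by
  have h₁ : ContDiffOn ℝ 4 (fun x : ℝ => Real.log (1 + x)) (Set.Ioo (-1) 1) :=
    ContDiffOn.log (by fun_prop) fun x hx => by linarith [hx.1]
  have h₂ : ContDiffOn ℝ 4 (fun x : ℝ => Real.log (1 - x)) (Set.Ioo (-1) 1) :=
    ContDiffOn.log (by fun_prop) fun x hx => by linarith [hx.2]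
  unfold Hfun binEnt
  fun_prop

lemma isLocalMax_Hfun {p : ℕ} {β h m : ℝ} (hm : isMaximizer p β h m) :
    IsLocalMax (Hfun p β h) m := by
  filter_upwards [isOpen_Ioo.mem_nhds hm.1] with x hx using hm.2 x ⟨hx.1.le, hx.2.le⟩

lemma arctanh_eq_of_isMaximizer {p : ℕ} {β h m : ℝ} (hm : isMaximizer p β h m) :
    arctanh m = β * (p * m ^ (p - 1)) + h := by
  have hd : HasDerivAt (Hfun p β h) (β * (p * m ^ (p - 1)) + h * 1 - arctanh m) m :=
    (((hasDerivAt_pow p m).const_mul β).add ((hasDerivAt_id m).const_mul h)).sub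
      (hasDerivAt_binEnt hm.1)
  linarith [(isLocalMax_Hfun hm).hasDerivAt_eq_zero hd]

lemma binEnt_neg (x : ℝ) : binEnt (-x) = binEnt x := by
  unfold binEnt; rw [← sub_eq_add_neg, sub_neg_eq_add]; ring

lemma binEnt_one_sub_le {t : ℝ} (ht₀ : 0 < t) (ht₁ : t < 1) :
    binEnt (1 - t) ≤ binEnt 1 + t * Real.log t / 2 := by
  have h₁ : Real.log (2 - t) ≤ Real.log 2 := Real.log_le_log (by linarith) (by linarith)
  have h₂ : 0 ≤ Real.log 2 := Real.log_nonneg (by norm_num)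
  unfold binEnt
  rw [show (1 : ℝ) + (1 - t) = 2 - t by ring, show (1 : ℝ) - (1 - t) = t by ring,
    show (1 : ℝ) + 1 = 2 by norm_num, sub_self, zero_mul]
  nlinarith

/-- The endpoints `±1` never maximize `H` on `[-1,1]`. -/
lemma exists_Hfun_endpoint_lt {p : ℕ} {β h s : ℝ} (hβ : 0 < β) (hh : 0 < h)
    (hs : s = 1 ∨ s = -1) :
    ∃ x ∈ Set.Icc (-1 : ℝ) 1, Hfun p β h s < Hfun p β h x := by
  set A : ℝ := β * p + h
  have hA : 0 < A := by positivity
  set t : ℝ := Real.exp (-(2 * A + 1))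
  have ht₀ : 0 < t := Real.exp_pos _
  have ht₁ : t < 1 := by
    rw [← Real.exp_zero]; exact Real.exp_lt_exp.2 (by linarith)
  have hlog : Real.log t = -(2 * A + 1) := Real.log_exp _
  have hbern : 1 - p * t ≤ (1 - t) ^ p := by
    have := one_add_mul_le_pow (show (-2 : ℝ) ≤ -t by linarith) p
    rw [← sub_eq_add_neg] at this
    linarith
  have hle1 : (1 - t) ^ p ≤ 1 := pow_le_one₀ (by linarith) (by linarith)
  have habs : |s ^ p| = 1 := by rcases hs with rfl | rfl <;> simp
  have hpow : s ^ p - p * t ≤ (s * (1 - t)) ^ p := by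
    rw [mul_pow]
    have : |s ^ p * (1 - (1 - t) ^ p)| ≤ p * t := by
      rw [abs_mul, habs, one_mul, abs_of_nonneg (by linarith)]; linarith
    linarith [(abs_le.1 this).2]
  have hent : binEnt (s * (1 - t)) ≤ binEnt s + t * Real.log t / 2 := by
    rcases hs with rfl | rfl
    · simpa using binEnt_one_sub_le ht₀ ht₁
    · rw [neg_one_mul, binEnt_neg, binEnt_neg]
      exact binEnt_one_sub_le ht₀ ht₁
  have hst : s * t ≤ t := by rcases hs with rfl | rfl <;> linarith
  refine ⟨s * (1 - t), ?_, ?_⟩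
  · rcases hs with rfl | rfl <;> constructor <;> linarith
  · unfold Hfun
    rw [hlog] at hent
    have e₁ := mul_le_mul_of_nonneg_left hpow hβ.le
    have e₂ := mul_le_mul_of_nonneg_left hst hh.le
    have e₃ : t * (-(2 * A + 1)) / 2 = -(β * (p * t) + h * t) - t / 2 := by
      simp only [A]; ring
    nlinarith

/-- Away from the unique maximizer, `H` stays a definite amount below its maximum. -/
lemma exists_gap {p : ℕ} {β h m r : ℝ} (hβ : 0 < β) (hh : 0 < h)
    (hm : isUniqueMaximizer p β h m) (hr : 0 < r) :
    ∃ η > 0, ∀ x ∈ Set.Icc (-1 : ℝ) 1, r ≤ |x - m| → Hfun p β h x ≤ Hfun p β h m - η := by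
  set S : Set ℝ := Set.Icc (-1) 1 ∩ {x | r ≤ |x - m|}
  have hS : IsCompact S :=
    isCompact_Icc.inter_right (isClosed_le continuous_const (by fun_prop))
  rcases S.eq_empty_or_nonempty with hemp | hne
  · refine ⟨1, one_pos, fun x hx hxr => ?_⟩
    have : x ∈ S := ⟨hx, hxr⟩
    simp [hemp] at this
  obtain ⟨y, ⟨hyI, hyr⟩, hy⟩ := hS.exists_isMaxOn hne (continuous_Hfun p β h).continuousOn
  have hlt : Hfun p β h y < Hfun p β h m := by
    refine lt_of_le_of_ne (hm.1.2 y hyI) fun heq => ?_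
    have hend : ¬ (y = 1 ∨ y = -1) := fun hs => by
      obtain ⟨x, hx, hlt⟩ := exists_Hfun_endpoint_lt (p := p) hβ hh hs
      linarith [hm.1.2 x hx]
    push Not at hend
    have hym : y = m := hm.2 y ⟨⟨lt_of_le_of_ne hyI.1 (Ne.symm hend.2),
      lt_of_le_of_ne hyI.2 hend.1⟩, fun x hx => heq ▸ hm.1.2 x hx⟩
    have : r ≤ |y - m| := hyr
    rw [hym, sub_self, abs_zero] at this
    linarith
  exact ⟨Hfun p β h m - Hfun p β h y, by linarith, fun x hx hxr => by
    have : Hfun p β h x ≤ Hfun p β h y := hy (show x ∈ S from ⟨hx, hxr⟩)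
    linarith⟩

/-- At a special point `H` drops by at least `c δ⁴` outside a `δ`-neighbourhood of its maximizer,
for all small `δ`. -/
lemma eventually_Hfun_le_sub_quartic {p : ℕ} {β h m c : ℝ} (hβ : 0 < β) (hh : 0 < h)
    (hsp : pSpecial p β h m) (hc₀ : 0 < c)
    (hc : c < -(iteratedDeriv 4 (Hfun p β h) m) / 24) :
    ∀ᶠ δ in 𝓝[>] (0 : ℝ), ∀ x ∈ Set.Icc (-1 : ℝ) 1, δ ≤ |x - m| →
      Hfun p β h x ≤ Hfun p β h m - c * δ ^ 4 := by
  have hloc := eventually_le_sub_quartic (convex_Ioo (-1) 1) isOpen_Ioo hsp.1.1.1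
    (contDiffOn_Hfun p β h) (isLocalMax_Hfun hsp.1.1) hsp.2 hc
  obtain ⟨r, hr, hball⟩ := Metric.eventually_nhds_iff.1 hloc
  obtain ⟨η, hη, hgap⟩ := exists_gap hβ hh hsp.1 hr
  have hsmall : ∀ᶠ δ in 𝓝[>] (0 : ℝ), c * δ ^ 4 < η := by
    have : Tendsto (fun δ : ℝ => c * δ ^ 4) (𝓝 0) (𝓝 (c * 0 ^ 4)) :=
      (by fun_prop : Continuous fun δ : ℝ => c * δ ^ 4).tendsto 0
    exact (this.mono_left nhdsWithin_le_nhds).eventually_lt_const (by simpa using hη)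
  filter_upwards [hsmall, self_mem_nhdsWithin] with δ hδ hδ₀ x hx hxδ
  rcases lt_or_ge |x - m| r with hlt | hge
  · have h₄ : δ ^ 4 ≤ (x - m) ^ 4 := by
      rw [← Even.pow_abs (by decide : Even 4) (x - m)]
      exact pow_le_pow_left₀ (le_of_lt hδ₀) hxδ 4
    have := hball (show dist x m < r by rwa [Real.dist_eq])
    nlinarith
  · linarith [hgap x hx hge]

lemma sum_prod_bool {N : ℕ} (g : Fin N → Bool → ℝ) :
    ∑ σ : Fin N → Bool, ∏ i, g i (σ i) = ∏ i, (g i true + g i false) := by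
  rw [← Fintype.piFinset_univ, Finset.sum_prod_piFinset]
  simp

/-- Likelihood of a configuration under the product measure on `{-1,1}^N` with mean `y`. -/
def tilt {N : ℕ} (y : ℝ) (σ : Fin N → Bool) : ℝ := ∏ i, (1 + y * spin (σ i)) / 2

lemma spin_eq_or (b : Bool) : spin b = 1 ∨ spin b = -1 := by cases b <;> simp [spin]

lemma abs_mag_le {N : ℕ} (σ : Fin N → Bool) : |mag σ| ≤ N := by
  refine (Finset.abs_sum_le_sum_abs _ _).trans ?_
  refine (Finset.sum_le_card_nsmul _ _ 1 fun i _ => ?_).trans (by simp)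
  rcases spin_eq_or (σ i) with h | h <;> simp [h]

lemma mag_div_mem_Icc {N : ℕ} (σ : Fin N → Bool) : mag σ / N ∈ Set.Icc (-1 : ℝ) 1 := by
  rw [Set.mem_Icc, ← abs_le, abs_div, Nat.abs_cast]
  exact div_le_one_of_le₀ (abs_mag_le σ) (Nat.cast_nonneg N)

lemma tilt_nonneg {N : ℕ} {y : ℝ} (hy : y ∈ Set.Icc (-1 : ℝ) 1) (σ : Fin N → Bool) :
    0 ≤ tilt y σ := by
  refine Finset.prod_nonneg fun i _ => ?_
  rcases spin_eq_or (σ i) with h | h <;> rw [h] <;> linarith [hy.1, hy.2]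

lemma sum_tilt (N : ℕ) (y : ℝ) : ∑ σ : Fin N → Bool, tilt y σ = 1 := by
  unfold tilt
  rw [sum_prod_bool fun _ b => (1 + y * spin b) / 2]
  refine Finset.prod_eq_one fun i _ => ?_
  simp only [spin]
  norm_num
  ring

lemma sum_tilt_mul_eq_zero {N : ℕ} (y : ℝ) {i j : Fin N} (hij : i ≠ j) :
    ∑ σ : Fin N → Bool, tilt y σ * ((spin (σ i) - y) * (spin (σ j) - y)) = 0 := by
  have hprod : ∀ σ : Fin N → Bool, tilt y σ * ((spin (σ i) - y) * (spin (σ j) - y)) =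
      ∏ k, (1 + y * spin (σ k)) / 2 * ((if k = i then spin (σ k) - y else 1) *
        (if k = j then spin (σ k) - y else 1)) := fun σ => by
    simp only [Finset.prod_mul_distrib, tilt, Finset.prod_ite_eq', Finset.mem_univ, if_true]
  simp only [hprod]
  rw [sum_prod_bool fun k b => (1 + y * spin b) / 2 * ((if k = i then spin b - y else 1) *
        (if k = j then spin b - y else 1))]
  refine Finset.prod_eq_zero (Finset.mem_univ i) ?_
  simp only [spin, if_pos, if_neg hij]
  norm_num
  ring

lemma sum_tilt_mul_sq {N : ℕ} (y : ℝ) (i : Fin N) :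
    ∑ σ : Fin N → Bool, tilt y σ * ((spin (σ i) - y) * (spin (σ i) - y)) = 1 - y ^ 2 := by
  have hprod : ∀ σ : Fin N → Bool, tilt y σ * ((spin (σ i) - y) * (spin (σ i) - y)) =
      ∏ k, (1 + y * spin (σ k)) / 2 * (if k = i then (spin (σ k) - y) * (spin (σ k) - y) else 1) :=
    fun σ => by
      simp only [Finset.prod_mul_distrib, tilt, Finset.prod_ite_eq', Finset.mem_univ, if_true]
  simp only [hprod]
  rw [sum_prod_bool fun k b => (1 + y * spin b) / 2 *
    (if k = i then (spin b - y) * (spin b - y) else 1)]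
  rw [Finset.prod_eq_single i]
  · simp only [spin, if_pos]
    norm_num
    ring
  · intro k _ hk
    simp only [spin, if_neg hk]
    norm_num
    ring
  · simp

/-- The variance of the magnetization under the product measure with mean `y`. -/
lemma sum_tilt_mul_mag_sub_sq (N : ℕ) (y : ℝ) :
    ∑ σ : Fin N → Bool, tilt y σ * (mag σ - N * y) ^ 2 = N * (1 - y ^ 2) := by
  have hmag : ∀ σ : Fin N → Bool, tilt y σ * (mag σ - N * y) ^ 2 =
      ∑ i, ∑ j, tilt y σ * ((spin (σ i) - y) * (spin (σ j) - y)) := fun σ => by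
    have : mag σ - N * y = ∑ i, (spin (σ i) - y) := by simp [mag]
    rw [this, sq, Finset.sum_mul_sum, Finset.mul_sum]
    simp only [Finset.mul_sum]
  simp only [hmag]
  rw [Finset.sum_comm]
  have hrow : ∀ i : Fin N, ∑ σ : Fin N → Bool, ∑ j,
      tilt y σ * ((spin (σ i) - y) * (spin (σ j) - y)) = 1 - y ^ 2 := fun i => by
    rw [Finset.sum_comm, Finset.sum_eq_single i]
    · exact sum_tilt_mul_sq y i
    · exact fun j _ hj => sum_tilt_mul_eq_zero y hj.symm
    · simp
  simp only [hrow, Finset.sum_const, Finset.card_univ, Fintype.card_fin, nsmul_eq_mul]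

lemma two_pow_mul_tilt {N : ℕ} {y : ℝ} (hy : y ∈ Set.Ioo (-1 : ℝ) 1) (σ : Fin N → Bool) :
    2 ^ N * tilt y σ = Real.exp (N * binEnt y + arctanh y * (mag σ - N * y)) := by
  have hp : (0 : ℝ) < 1 + y := by linarith [hy.1]
  have hn : (0 : ℝ) < 1 - y := by linarith [hy.2]
  have hfactor : ∀ b : Bool,
      1 + y * spin b = Real.exp (binEnt y + arctanh y * (spin b - y)) := fun b => by
    rw [arctanh, Real.log_div hp.ne' hn.ne', binEnt]
    rcases spin_eq_or b with h | h <;> rw [h]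
    · rw [mul_one, ← Real.exp_log hp]
      congr 1
      rw [Real.exp_log hp]
      ring
    · rw [mul_neg_one, ← sub_eq_add_neg, ← Real.exp_log hn]
      congr 1
      rw [Real.exp_log hn]
      ring
  have hsum : N * binEnt y + arctanh y * (mag σ - N * y)
      = ∑ i, (binEnt y + arctanh y * (spin (σ i) - y)) := by
    rw [Finset.sum_add_distrib, ← Finset.mul_sum, Finset.sum_sub_distrib]
    simp [mag]
  rw [hsum, Real.exp_sum, tilt, Finset.prod_div_distrib]
  simp only [hfactor, Finset.prod_const, Finset.card_univ, Fintype.card_fin]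
  field_simp

lemma spin_eq_of_mag_eq {N : ℕ} {s : ℝ} (hs : s = 1 ∨ s = -1) {σ : Fin N → Bool}
    (hσ : mag σ = s * N) (i : Fin N) : spin (σ i) = s := by
  have hss : s * s = 1 := by rcases hs with rfl | rfl <;> norm_num
  have hzero : ∑ i, (1 - s * spin (σ i)) = 0 := by
    rw [Finset.sum_sub_distrib, ← Finset.mul_sum, ← mag, hσ, ← mul_assoc, hss]
    simp
  have hi := (Finset.sum_eq_zero_iff_of_nonneg fun i _ => by
    rcases hs with rfl | rfl <;> rcases spin_eq_or (σ i) with h | h <;> rw [h] <;> norm_num).1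
      hzero i (Finset.mem_univ i)
  calc spin (σ i) = s * s * spin (σ i) := by rw [hss, one_mul]
    _ = s * (s * spin (σ i)) := by ring
    _ = s := by rw [show s * spin (σ i) = 1 by linarith, mul_one]

lemma two_pow_mul_tilt_self {N : ℕ} (hN : N ≠ 0) (σ : Fin N → Bool) :
    2 ^ N * tilt (mag σ / N) σ = Real.exp (N * binEnt (mag σ / N)) := by
  have hN' : (N : ℝ) ≠ 0 := Nat.cast_ne_zero.2 hN
  have hI := mag_div_mem_Icc σ
  by_cases hend : mag σ / N = 1 ∨ mag σ / N = -1
  · have hent : binEnt (mag σ / N) = Real.log 2 := by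
      rcases hend with h | h <;> rw [h] <;> norm_num [binEnt] <;> ring
    have htilt : tilt (mag σ / N) σ = 1 := by
      refine Finset.prod_eq_one fun i _ => ?_
      rw [spin_eq_of_mag_eq hend (div_mul_cancel₀ _ hN').symm i]
      rcases hend with h | h <;> rw [h] <;> norm_num
    rw [hent, htilt, mul_one, Real.exp_nat_mul, Real.exp_log two_pos]
  · push Not at hend
    rw [two_pow_mul_tilt ⟨lt_of_le_of_ne hI.1 hend.2.symm, lt_of_le_of_ne hI.2 hend.1⟩,
      mul_div_cancel₀ _ hN', sub_self, mul_zero, add_zero]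

lemma exists_mag_eq {N : ℕ} (σ : Fin N → Bool) :
    ∃ k ∈ Finset.range (N + 1), mag σ = 2 * k - N := by
  refine ⟨(Finset.univ.filter fun i => σ i = true).card, ?_, ?_⟩
  · rw [Finset.mem_range, Nat.lt_succ_iff]
    exact (Finset.card_le_univ _).trans_eq (Fintype.card_fin N)
  · have : ∀ b : Bool, spin b = 2 * (if b = true then 1 else 0) - 1 := fun b => by
      cases b <;> norm_num [spin]
    simp only [mag, this]
    rw [Finset.sum_sub_distrib, ← Finset.mul_sum]
    simp

/-- The maximum likelihoods of all configurations add up to at most `N + 1`. -/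
lemma sum_tilt_self_le {N : ℕ} (hN : N ≠ 0) :
    ∑ σ : Fin N → Bool, tilt (mag σ / N) σ ≤ N + 1 := by
  have hN' : (0 : ℝ) < N := Nat.cast_pos.2 (Nat.pos_of_ne_zero hN)
  have hle : ∀ σ : Fin N → Bool, tilt (mag σ / N) σ ≤
      ∑ k ∈ Finset.range (N + 1), tilt ((2 * k - N) / N) σ := fun σ => by
    obtain ⟨k, hk, hkσ⟩ := exists_mag_eq σ
    rw [hkσ]
    refine Finset.single_le_sum (f := fun k : ℕ => tilt ((2 * (k : ℝ) - N) / N) σ)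
      (fun l hl => tilt_nonneg ?_ σ) hk
    have hlN : (l : ℝ) ≤ N := by exact_mod_cast Nat.lt_succ_iff.1 (Finset.mem_range.1 hl)
    have hl0 : (0 : ℝ) ≤ l := Nat.cast_nonneg l
    rw [Set.mem_Icc, le_div_iff₀ hN', div_le_iff₀ hN']
    constructor <;> linarith
  calc ∑ σ : Fin N → Bool, tilt (mag σ / N) σ
      ≤ ∑ σ : Fin N → Bool, ∑ k ∈ Finset.range (N + 1), tilt ((2 * k - N) / N) σ :=
        Finset.sum_le_sum fun σ _ => hle σ
    _ = N + 1 := by rw [Finset.sum_comm]; simp [sum_tilt]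

lemma cwHamiltonian_eq {p N : ℕ} (hN : N ≠ 0) (β h : ℝ) (σ : Fin N → Bool) :
    cwHamiltonian p N β h σ = N * (β * (mag σ / N) ^ p + h * (mag σ / N)) := by
  have hN' : (N : ℝ) ≠ 0 := Nat.cast_ne_zero.2 hN
  rw [cwHamiltonian, ← Fintype.sum_pow fun i => spin (σ i), ← mag, zpow_sub₀ hN', zpow_one,
    zpow_natCast, div_pow]
  field_simp

lemma cwWeight_eq {p N : ℕ} (hN : N ≠ 0) (β h : ℝ) (σ : Fin N → Bool) :
    cwWeight p N β h σ =
      2 ^ N * Real.exp (N * Hfun p β h (mag σ / N)) * tilt (mag σ / N) σ := by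
  rw [mul_right_comm, two_pow_mul_tilt_self hN, ← Real.exp_add, cwWeight, cwHamiltonian_eq hN]
  congr 1
  unfold Hfun
  ring

lemma abs_pow_sub_tangent_le {m x : ℝ} (hm : |m| ≤ 1) (hx : |x| ≤ 1) (n : ℕ) :
    |x ^ n - m ^ n - n * m ^ (n - 1) * (x - m)| ≤ (n : ℝ) ^ 2 * (x - m) ^ 2 := by
  induction n with
  | zero => simp
  | succ n ih =>
    have hdecomp : x ^ (n + 1) - m ^ (n + 1) - ((n + 1 : ℕ) : ℝ) * m ^ (n + 1 - 1) * (x - m)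
        = x * (x ^ n - m ^ n - n * m ^ (n - 1) * (x - m))
          + n * m ^ (n - 1) * (x - m) ^ 2 := by
      rcases n with _ | n
      · simp
      · simp only [Nat.add_sub_cancel]
        push_cast
        ring
    have h₁ : |x * (x ^ n - m ^ n - n * m ^ (n - 1) * (x - m))| ≤ (n : ℝ) ^ 2 * (x - m) ^ 2 := by
      rw [abs_mul]
      exact (mul_le_of_le_one_left (abs_nonneg _) hx).trans ih
    have h₂ : |n * m ^ (n - 1) * (x - m) ^ 2| ≤ n * (x - m) ^ 2 := by
      rw [abs_mul, abs_mul, abs_pow, Nat.abs_cast, abs_of_nonneg (sq_nonneg (x - m))]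
      refine mul_le_mul_of_nonneg_right ?_ (sq_nonneg _)
      exact mul_le_of_le_one_right (Nat.cast_nonneg n) (pow_le_one₀ (abs_nonneg m) hm)
    rw [hdecomp]
    refine (abs_add_le _ _).trans ((add_le_add h₁ h₂).trans ?_)
    push_cast
    nlinarith [sq_nonneg (x - m), mul_nonneg (Nat.cast_nonneg (α := ℝ) n) (sq_nonneg (x - m))]

lemma le_cwWeight {p N : ℕ} (hN : N ≠ 0) {β h m : ℝ} (hβ : 0 < β) (hm : isMaximizer p β h m)
    (σ : Fin N → Bool) :
    2 ^ N * tilt m σ * Real.exp (N * (Hfun p β h m - β * p ^ 2 * (mag σ / N - m) ^ 2))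
      ≤ cwWeight p N β h σ := by
  have hN' : (N : ℝ) ≠ 0 := Nat.cast_ne_zero.2 hN
  rw [two_pow_mul_tilt hm.1, ← Real.exp_add, cwWeight, cwHamiltonian_eq hN,
    arctanh_eq_of_isMaximizer hm]
  refine Real.exp_le_exp.2 ?_
  have htan := (abs_le.1 (abs_pow_sub_tangent_le (abs_le.2 ⟨hm.1.1.le, hm.1.2.le⟩)
    (abs_le.2 (mag_div_mem_Icc σ)) p)).1
  set x := mag σ / N with hx
  have hmag : mag σ = N * x := by rw [hx]; field_simp
  have := mul_le_mul_of_nonneg_left htan (mul_nonneg (Nat.cast_nonneg N) hβ.le)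
  rw [hmag]
  unfold Hfun
  linarith

/-- Lower bound for the partition function by tilting to the product measure with mean `m`. -/
lemma le_sum_cwWeight {p N : ℕ} (hN : N ≠ 0) {β h m : ℝ} (hβ : 0 < β)
    (hm : isMaximizer p β h m) :
    2 ^ N * Real.exp (N * Hfun p β h m - β * p ^ 2) ≤ ∑ σ : Fin N → Bool, cwWeight p N β h σ := by
  have hN' : (0 : ℝ) < N := Nat.cast_pos.2 (Nat.pos_of_ne_zero hN)
  set K : ℝ := β * p ^ 2
  have hK : 0 ≤ K := by positivity
  set E : ℝ := 2 ^ N * Real.exp (N * Hfun p β h m - K)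
  have hE : 0 ≤ E := by positivity
  have hterm : ∀ σ : Fin N → Bool,
      E * (tilt m σ * (1 + K) - K / N * (tilt m σ * (mag σ - N * m) ^ 2)) ≤
        cwWeight p N β h σ := fun σ => by
    refine le_trans ?_ (le_cwWeight hN hβ hm σ)
    have ht : 0 ≤ tilt m σ := tilt_nonneg ⟨hm.1.1.le, hm.1.2.le⟩ σ
    have hexp := Real.add_one_le_exp (K - N * (K * (mag σ / N - m) ^ 2))
    have hsplit : Real.exp (N * (Hfun p β h m - K * (mag σ / N - m) ^ 2)) =
        Real.exp (N * Hfun p β h m - K) * Real.exp (K - N * (K * (mag σ / N - m) ^ 2)) := by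
      rw [← Real.exp_add]; congr 1; ring
    rw [hsplit]
    calc E * (tilt m σ * (1 + K) - K / N * (tilt m σ * (mag σ - N * m) ^ 2))
        = E * tilt m σ * (K - N * (K * (mag σ / N - m) ^ 2) + 1) := by field_simp; ring
      _ ≤ E * tilt m σ * Real.exp (K - N * (K * (mag σ / N - m) ^ 2)) :=
        mul_le_mul_of_nonneg_left hexp (mul_nonneg hE ht)
      _ = _ := by simp only [E]; ring
  refine le_trans ?_ (Finset.sum_le_sum fun σ _ => hterm σ)
  rw [← Finset.mul_sum, Finset.sum_sub_distrib, ← Finset.sum_mul, ← Finset.mul_sum, sum_tilt,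
    sum_tilt_mul_mag_sub_sq]
  refine le_mul_of_one_le_right hE ?_
  have : K / N * (N * (1 - m ^ 2)) = K - K * m ^ 2 := by field_simp
  rw [this]
  nlinarith [mul_nonneg hK (sq_nonneg m)]

/-- Upper bound for the Gibbs weight of an event on whose magnetizations `H` is at most `a`. -/
lemma sum_indicator_cwWeight_le {p N : ℕ} (hN : N ≠ 0) {β h a : ℝ} {E : Set (Fin N → Bool)}
    (hE : ∀ σ ∈ E, Hfun p β h (mag σ / N) ≤ a) :
    ∑ σ : Fin N → Bool, E.indicator (cwWeight p N β h) σ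
      ≤ 2 ^ N * Real.exp (N * a) * (N + 1) := by
  have hterm : ∀ σ : Fin N → Bool, E.indicator (cwWeight p N β h) σ ≤
      2 ^ N * Real.exp (N * a) * tilt (mag σ / N) σ := fun σ => by
    have ht := tilt_nonneg (mag_div_mem_Icc σ) σ
    refine Set.indicator_apply_le' (fun hσ => ?_) fun _ => by positivity
    rw [cwWeight_eq hN]
    have := hE σ hσ
    gcongr
  refine (Finset.sum_le_sum fun σ _ => hterm σ).trans ?_
  rw [← Finset.mul_sum]
  exact mul_le_mul_of_nonneg_left (sum_tilt_self_le hN) (by positivity)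

/-- **Concentration of the empirical magnetization at a `p`-special point.** -/
theorem concentration_special
    (p : ℕ) (hp : 3 ≤ p) (β h m : ℝ) (hβ : 0 < β) (hh : 0 < h)
    (hsp : pSpecial p β h m) :
    ∀ c : ℝ, 0 < c → c < -(iteratedDeriv 4 (Hfun p β h) m) / 24 →
      ∃ C : ℝ, 0 < C ∧ ∃ N₀ : ℕ, ∀ N : ℕ, N₀ ≤ N →
        cwProb p N β h
            {σ | |mag σ / N - m| ≥ (N : ℝ) ^ (-(1:ℝ)/4 + (0.24 : ℝ))}
          ≤ C * (N : ℝ) ^ ((3:ℝ)/2) * Real.exp (-c * (N : ℝ) ^ (4 * (0.24 : ℝ))) := by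
  intro c hc₀ hc
  have hm := hsp.1.1
  have hδ : Tendsto (fun N : ℕ => (N : ℝ) ^ (-(1:ℝ)/4 + (0.24 : ℝ))) atTop (𝓝[>] 0) := by
    refine tendsto_nhdsWithin_iff.2 ⟨?_, ?_⟩
    · have := (tendsto_rpow_neg_atTop (show (0 : ℝ) < 0.01 by norm_num)).comp
        (tendsto_natCast_atTop_atTop (R := ℝ))
      refine this.congr fun N => ?_
      norm_num [Function.comp]
    · filter_upwards [eventually_gt_atTop 0] with N hN
      exact Real.rpow_pos_of_pos (Nat.cast_pos.2 hN) _
  obtain ⟨N₀, hN₀⟩ := eventually_atTop.1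
    ((hδ.eventually (eventually_Hfun_le_sub_quartic hβ hh hsp hc₀ hc)).and
      (eventually_gt_atTop 0))
  refine ⟨2 * Real.exp (β * p ^ 2), by positivity, N₀, fun N hN => ?_⟩
  obtain ⟨hH, hNpos⟩ := hN₀ N hN
  have hN' : (0 : ℝ) < N := Nat.cast_pos.2 hNpos
  have hN1 : (1 : ℝ) ≤ N := Nat.one_le_cast.2 hNpos
  have hpow : (N : ℝ) * ((N : ℝ) ^ (-(1:ℝ)/4 + (0.24 : ℝ))) ^ 4 = (N : ℝ) ^ (4 * (0.24 : ℝ)) := by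
    rw [← Real.rpow_natCast, ← Real.rpow_mul hN'.le]
    nth_rewrite 1 [← Real.rpow_one (N : ℝ)]
    rw [← Real.rpow_add hN']
    norm_num
  set δ : ℝ := (N : ℝ) ^ (-(1:ℝ)/4 + (0.24 : ℝ))
  have hupper := sum_indicator_cwWeight_le (N := N) (E := {σ | |mag σ / N - m| ≥ δ}) hNpos.ne'
    fun σ hσ => hH _ (mag_div_mem_Icc σ) hσ
  have hlower := le_sum_cwWeight hNpos.ne' hβ hm
  have hgrow : (N : ℝ) + 1 ≤ 2 * (N : ℝ) ^ ((3:ℝ)/2) := by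
    have := Real.self_le_rpow_of_one_le hN1 (show (1 : ℝ) ≤ 3 / 2 by norm_num)
    linarith
  have hexp : Real.exp (N * (Hfun p β h m - c * δ ^ 4)) =
      Real.exp (N * Hfun p β h m - β * p ^ 2) * Real.exp (β * p ^ 2) *
        Real.exp (-c * (N : ℝ) ^ (4 * (0.24 : ℝ))) := by
    rw [← Real.exp_add, ← Real.exp_add, ← hpow]
    congr 1
    ring
  unfold cwProb
  rw [div_le_iff₀ (lt_of_lt_of_le (by positivity) hlower)]
  have hsum := (by positivity : (0 : ℝ) ≤ 2 ^ N * Real.exp (N * Hfun p β h m - β * p ^ 2)).trans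
    hlower
  refine hupper.trans ?_
  rw [hexp]
  calc _ = (2 ^ N * Real.exp (N * Hfun p β h m - β * p ^ 2)) *
        (Real.exp (β * p ^ 2) * Real.exp (-c * (N : ℝ) ^ (4 * (0.24 : ℝ))) * (N + 1)) := by ring
    _ ≤ (∑ σ : Fin N → Bool, cwWeight p N β h σ) * (Real.exp (β * p ^ 2) *
        Real.exp (-c * (N : ℝ) ^ (4 * (0.24 : ℝ))) * (2 * (N : ℝ) ^ ((3:ℝ)/2))) := by gcongr
    _ = _ := by ring
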